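/- arXiv:2309.04995 — 9 statements merged into one kernel-verified Lean document; each statement's English description precedes it below -/
import Mathlib

section
/- Let S₁ and S₂ be finite sets of natural numbers, and for a finite set S of naturals let N(S) = ∑_{i ∈ S} 2^i. Then S₁ and S₂ are disjoint if and only if the number of ones in the binary representation of N(S₁) + N(S₂) equals |S₁| + |S₂|. -/
/-- The number of ones in the binary representation of `n` (its popcount). -/
def popcount (n : ℕ) : ℕ := (Nat.bits n).count true

theorem popcount_two_mul (n : ℕ) : popcount (2 * n) = popcount n := by
  rcases Nat.eq_zero_or_pos n with rfl | hn
  · rfl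
  · simp [popcount, Nat.bit0_bits n hn.ne']

theorem popcount_two_mul_add_one (n : ℕ) : popcount (2 * n + 1) = popcount n + 1 := by
  simp [popcount]

theorem popcount_eq_length_bitIndices (n : ℕ) : popcount n = n.bitIndices.length := by
  induction n using Nat.strong_induction_on with
  | _ n ih =>
    obtain ⟨k, rfl | rfl⟩ := Nat.even_or_odd' n
    · rcases Nat.eq_zero_or_pos k with rfl | hk
      · simp [popcount]
      · simp [popcount_two_mul, ih k (by omega)]
    · simp [popcount_two_mul_add_one, ih k (by omega)]

theorem popcount_sum_two_pow (S : Finset ℕ) : popcount (∑ i ∈ S, 2 ^ i) = S.card := by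
  rw [popcount_eq_length_bitIndices, ← List.toFinset_card_of_nodup Nat.bitIndices_nodup,
    Finset.toFinset_bitIndices_sum_two_pow]

theorem popcount_two_pow (k : ℕ) : popcount (2 ^ k) = 1 := by
  simp [popcount_eq_length_bitIndices]

theorem popcount_succ_le (n : ℕ) : popcount (n + 1) ≤ popcount n + 1 := by
  induction n using Nat.strong_induction_on with
  | _ n ih =>
    obtain ⟨k, rfl | rfl⟩ := Nat.even_or_odd' n
    · rw [popcount_two_mul_add_one, popcount_two_mul]
    · have := ih k (by omega)
      rw [show 2 * k + 1 + 1 = 2 * (k + 1) by ring, popcount_two_mul, popcount_two_mul_add_one]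
      omega

theorem popcount_add_le (m n : ℕ) : popcount (m + n) ≤ popcount m + popcount n := by
  induction m using Nat.strong_induction_on generalizing n with
  | _ m ih =>
    rcases Nat.eq_zero_or_pos m with rfl | hm
    · simp
    obtain ⟨a, ha⟩ := Nat.even_or_odd' m
    obtain ⟨b, hb⟩ := Nat.even_or_odd' n
    have hab := ih a (by omega) b
    have hsucc := popcount_succ_le (a + b)
    rcases ha with rfl | rfl <;> rcases hb with rfl | rfl
    · rw [← mul_add]
      simpa only [popcount_two_mul] using hab
    · rw [← add_assoc, ← mul_add]
      simp only [popcount_two_mul, popcount_two_mul_add_one]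
      omega
    · rw [show 2 * a + 1 + 2 * b = 2 * (a + b) + 1 by ring]
      simp only [popcount_two_mul, popcount_two_mul_add_one]
      omega
    · rw [show 2 * a + 1 + (2 * b + 1) = 2 * (a + b + 1) by ring]
      simp only [popcount_two_mul, popcount_two_mul_add_one]
      omega

/-- Two finite sets of naturals `S₁`, `S₂` are disjoint iff the popcount of
`N(S₁) + N(S₂)`, where `N(S) = ∑_{i ∈ S} 2^i`, equals `|S₁| + |S₂|`. -/
theorem disjoint_iff_popcount_add (S₁ S₂ : Finset ℕ) :
    Disjoint S₁ S₂ ↔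
      popcount ((∑ i ∈ S₁, 2 ^ i) + ∑ i ∈ S₂, 2 ^ i) = S₁.card + S₂.card := by
  refine ⟨fun h => ?_, fun h => ?_⟩
  · rw [← Finset.sum_union h, popcount_sum_two_pow, Finset.card_union_of_disjoint h]
  · rw [Finset.disjoint_left]
    intro i h₁ h₂
    have key : (∑ j ∈ S₁, 2 ^ j) + ∑ j ∈ S₂, 2 ^ j =
        (∑ j ∈ S₁.erase i, 2 ^ j) + (∑ j ∈ S₂.erase i, 2 ^ j) + 2 ^ (i + 1) := by
      rw [← Finset.add_sum_erase S₁ _ h₁, ← Finset.add_sum_erase S₂ _ h₂]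
      ring
    have hle := popcount_add_le
      ((∑ j ∈ S₁.erase i, 2 ^ j) + ∑ j ∈ S₂.erase i, 2 ^ j) (2 ^ (i + 1))
    have hle' := popcount_add_le (∑ j ∈ S₁.erase i, 2 ^ j) (∑ j ∈ S₂.erase i, 2 ^ j)
    rw [← key, h, popcount_two_pow] at hle
    rw [popcount_sum_two_pow, popcount_sum_two_pow] at hle'
    have := Finset.card_erase_add_one h₁
    have := Finset.card_erase_add_one h₂
    omega
end

section
/- Let X be a finite set with |X| = 3·m̃, let B be a positive integer, and let s : X → ℕ satisfy 4·s(x) > B and 2·s(x) < B for every x ∈ X, with ∑_{x ∈ X} s(x) = m̃·B. Then the following are equivalent: (i) X can be partitioned into m̃ pairwise disjoint sets X₁, …, X_m̃ with ∑_{x ∈ Xᵢ} s(x) = B for each i; (ii) there exists φ : Fin m̃ → Finset X with pairwise disjoint values such that ∑_{x ∈ φ(i)} (B − s(x)) ≥ 2·B for every i (subtraction of naturals, which is exact here since s(x) < B). -/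
theorem Finset.sum_tsub_add_sum_eq_card_mul {X : Type*} (A : Finset X) (B : ℕ) (s : X → ℕ)
    (hs : ∀ x ∈ A, s x ≤ B) : ∑ x ∈ A, (B - s x) + ∑ x ∈ A, s x = A.card * B := by
  rw [← Finset.sum_add_distrib, Finset.sum_congr rfl fun x hx => Nat.sub_add_cancel (hs x hx),
    Finset.sum_const, smul_eq_mul]

theorem card_eq_three_of_sum_eq {X : Type*} (A : Finset X) {B : ℕ} (hB : 1 ≤ B) (s : X → ℕ)
    (hs₁ : ∀ x, B < 4 * s x) (hs₂ : ∀ x, 2 * s x < B) (hA : ∑ x ∈ A, s x = B) :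
    A.card = 3 := by
  have hne : A.Nonempty := Finset.nonempty_of_sum_ne_zero (by omega : ∑ x ∈ A, s x ≠ 0)
  have h₁ := Finset.sum_lt_sum_of_nonempty hne fun x _ => hs₁ x
  have h₂ := Finset.sum_lt_sum_of_nonempty hne fun x _ => hs₂ x
  rw [← Finset.mul_sum, hA, Finset.sum_const, smul_eq_mul] at h₁ h₂
  have h₃ := Nat.lt_of_mul_lt_mul_right h₁
  have h₄ := Nat.lt_of_mul_lt_mul_right h₂
  omega

theorem three_le_card_of_two_mul_le_sum {X : Type*} (A : Finset X) {B : ℕ} (hB : 1 ≤ B)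
    (s : X → ℕ) (hs₁ : ∀ x, B < 4 * s x) (hA : 2 * B ≤ ∑ x ∈ A, (B - s x)) :
    3 ≤ A.card := by
  have h : ∑ x ∈ A, 4 * (B - s x) ≤ ∑ _x ∈ A, 3 * B :=
    Finset.sum_le_sum fun x _ => by have := hs₁ x; omega
  rw [← Finset.mul_sum, Finset.sum_const, smul_eq_mul] at h
  by_contra! hlt
  have : A.card * (3 * B) ≤ 2 * (3 * B) := Nat.mul_le_mul_right _ (by omega)
  omega

/-- Correctness of the reduction from 3-Partition to CFFA with an edgeless conflict
graph: a 3-Partition instance (with `m'` triples) is a yes-instance iff the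
corresponding CFFA instance (with `m'` agents, uniform utilities `B - s x` and
threshold `2B`) is a yes-instance. -/
theorem threePartition_iff_cffa_edgeless {X : Type*} [Fintype X] [DecidableEq X]
    (m' B : ℕ) (hB : 1 ≤ B) (hcard : Fintype.card X = 3 * m')
    (s : X → ℕ) (hs₁ : ∀ x, B < 4 * s x) (hs₂ : ∀ x, 2 * s x < B)
    (hsum : ∑ x, s x = m' * B) :
    (∃ ψ : Fin m' → Finset X,
        (∀ i j : Fin m', i ≠ j → Disjoint (ψ i) (ψ j)) ∧
        (Finset.univ.biUnion ψ = Finset.univ) ∧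
        (∀ i : Fin m', ∑ x ∈ ψ i, s x = B)) ↔
    (∃ φ : Fin m' → Finset X,
        (∀ i j : Fin m', i ≠ j → Disjoint (φ i) (φ j)) ∧
        (∀ i : Fin m', 2 * B ≤ ∑ x ∈ φ i, (B - s x))) := by
  have hle : ∀ x, s x ≤ B := fun x => by have := hs₂ x; omega
  constructor
  · rintro ⟨ψ, hdisj, -, hψ⟩
    refine ⟨ψ, hdisj, fun i => ?_⟩
    have h := Finset.sum_tsub_add_sum_eq_card_mul (ψ i) B s fun x _ => hle x
    rw [hψ i, card_eq_three_of_sum_eq (ψ i) hB s hs₁ hs₂ (hψ i)] at h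
    omega
  · rintro ⟨φ, hdisj, hφ⟩
    have hpair : ((Finset.univ : Finset (Fin m')) : Set (Fin m')).PairwiseDisjoint φ :=
      fun i _ j _ hij => hdisj i j hij
    have hthree : ∀ i ∈ Finset.univ, 3 ≤ (φ i).card := fun i _ =>
      three_le_card_of_two_mul_le_sum (φ i) hB s hs₁ (hφ i)
    have hunion := Finset.card_biUnion hpair
    have hconst : ∑ _i : Fin m', 3 = Fintype.card X := by simp [hcard, mul_comm]
    have hbound := Finset.card_le_univ (Finset.univ.biUnion φ)
    have hge := Finset.sum_le_sum hthree
    have hcards := (Finset.sum_eq_sum_iff_of_le hthree).1 (by omega)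
    have hcover : Finset.univ.biUnion φ = Finset.univ :=
      (Finset.card_eq_iff_eq_univ _).1 (by omega)
    have hsle : ∀ i ∈ Finset.univ, ∑ x ∈ φ i, s x ≤ B := fun i hi => by
      have h := Finset.sum_tsub_add_sum_eq_card_mul (φ i) B s fun x _ => hle x
      rw [← hcards i hi] at h
      have := hφ i
      omega
    have htotal : ∑ i, ∑ x ∈ φ i, s x = ∑ _i : Fin m', B := by
      rw [← Finset.sum_biUnion hpair, hcover, hsum]
      simp
    exact ⟨φ, hdisj, hcover, fun i =>
      (Finset.sum_eq_sum_iff_of_le hsle).1 htotal i (Finset.mem_univ i)⟩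
end

section
/- Let X be a finite set with |X| = 3·m̃, let B be a positive integer, and let s : X → ℕ satisfy 4·s(x) > B and 2·s(x) < B for every x ∈ X, with ∑_{x ∈ X} s(x) = m̃·B. Then for every φ : Fin m̃ → Finset X with pairwise disjoint values such that ∑_{x ∈ φ(i)} (B − s(x)) ≥ 2·B for every i, each bundle φ(i) has exactly 3 elements, ∑_{x ∈ φ(i)} (B − s(x)) = 2·B, and ∑_{x ∈ φ(i)} s(x) = B for every i. -/
/-- Rigidity of CFFA solutions in the 3-Partition reduction: given a 3-Partition
instance, every CFFA solution for the edgeless conflict graph with uniform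
utilities `B - s x` and threshold `2B` consists of bundles of exactly 3 elements,
each of utility exactly `2B` and of `s`-sum exactly `B`. -/
theorem cffa_edgeless_solution_rigid {X : Type*} [Fintype X] [DecidableEq X]
    (m' B : ℕ) (hB : 1 ≤ B) (hcard : Fintype.card X = 3 * m')
    (s : X → ℕ) (hs₁ : ∀ x, B < 4 * s x) (hs₂ : ∀ x, 2 * s x < B)
    (hsum : ∑ x, s x = m' * B)
    (φ : Fin m' → Finset X)
    (hdisj : ∀ i j : Fin m', i ≠ j → Disjoint (φ i) (φ j))
    (hutil : ∀ i : Fin m', 2 * B ≤ ∑ x ∈ φ i, (B - s x)) :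
    ∀ i : Fin m',
      (φ i).card = 3 ∧ (∑ x ∈ φ i, (B - s x)) = 2 * B ∧ (∑ x ∈ φ i, s x) = B := by
  intro i
  have add_utility (t : Finset X) : ∑ x ∈ t, (B - s x) + ∑ x ∈ t, s x = t.card * B := by
    rw [← Finset.sum_add_distrib, ← smul_eq_mul, ← Finset.sum_const]
    exact Finset.sum_congr rfl fun x _ => Nat.sub_add_cancel (by have := hs₂ x; omega)
  have total : ∑ x, (B - s x) = m' * (2 * B) := by
    have h := add_utility Finset.univ
    rw [hsum, Finset.card_univ, hcard] at h
    linarith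
  have sum_bundles_le : ∑ j, ∑ x ∈ φ j, (B - s x) ≤ ∑ _j : Fin m', 2 * B := by
    rw [← Finset.sum_biUnion fun j _ k _ hjk => hdisj j k hjk, Finset.sum_const,
      Finset.card_univ, Fintype.card_fin, smul_eq_mul, ← total]
    exact Finset.sum_le_sum_of_subset (Finset.subset_univ _)
  have utility_eq : ∑ x ∈ φ i, (B - s x) = 2 * B :=
    ((Finset.sum_eq_sum_iff_of_le fun j _ => hutil j).mp
      (le_antisymm (Finset.sum_le_sum fun j _ => hutil j) sum_bundles_le) i
      (Finset.mem_univ i)).symm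
  have upper : 4 * ∑ x ∈ φ i, (B - s x) ≤ (φ i).card * (3 * B) := by
    rw [Finset.mul_sum, ← smul_eq_mul (φ i).card]
    exact Finset.sum_le_card_nsmul _ _ _ fun x _ => by have := hs₁ x; omega
  have lower : (φ i).card * (B + 1) ≤ 2 * ∑ x ∈ φ i, (B - s x) := by
    rw [Finset.mul_sum, ← smul_eq_mul (φ i).card]
    exact Finset.card_nsmul_le_sum _ _ _ fun x _ => by have := hs₂ x; omega
  rw [utility_eq] at upper lower
  have card_eq : (φ i).card = 3 := by
    apply le_antisymm
    · by_contra! h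
      nlinarith
    · by_contra! h
      nlinarith
  have h := add_utility (φ i)
  rw [utility_eq, card_eq] at h
  exact ⟨card_eq, utility_eq, by omega⟩
end

section
/- Let X, Y, Z be pairwise disjoint finite sets, each of cardinality m̃, let B be a positive integer, and let s : X ∪ Y ∪ Z → ℕ satisfy s(a) ≥ 1 for every a and ∑_{a ∈ X∪Y∪Z} s(a) = m̃·B. Then the following are equivalent: (i) X ∪ Y ∪ Z can be partitioned into m̃ pairwise disjoint sets A₁, …, A_m̃ such that each Aᵢ contains exactly one element of X, exactly one element of Y, and exactly one element of Z, and ∑_{a ∈ Aᵢ} s(a) = B; (ii) there exists φ : Fin m̃ → Finset (X ∪ Y ∪ Z) with pairwise disjoint values such that for every i, |φ(i) ∩ X| ≤ 1, |φ(i) ∩ Y| ≤ 1, |φ(i) ∩ Z| ≤ 1, and ∑_{a ∈ φ(i)} s(a) ≥ B. -/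
/-- If pairwise disjoint sets `φ i` cover `X`, there are as many of them as elements of `X`, and each
contains at most one element of `X`, then each contains exactly one. -/
theorem card_inter_eq_one_of_pairwise_disjoint {ι α : Type*} [Fintype ι] [DecidableEq α]
    {φ : ι → Finset α} {X : Finset α} (hd : ∀ i j, i ≠ j → Disjoint (φ i) (φ j))
    (hcov : X ⊆ Finset.univ.biUnion φ) (hX : X.card = Fintype.card ι)
    (hle : ∀ i, (φ i ∩ X).card ≤ 1) (i : ι) : (φ i ∩ X).card = 1 := by
  have hcard : ∑ i, (φ i ∩ X).card = ∑ _i : ι, 1 := by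
    rw [← Finset.card_biUnion fun i _ j _ hij =>
        (hd i j hij).mono Finset.inter_subset_left Finset.inter_subset_left,
      ← Finset.biUnion_inter, Finset.inter_eq_right.mpr hcov, hX]
    simp
  exact (Finset.sum_eq_sum_iff_of_le fun i _ => hle i).mp hcard i (Finset.mem_univ i)

/-- Correctness of the reduction from Numerical 3-Dimensional Matching to CFFA on
a cluster graph with three cliques `X`, `Y`, `Z`: the N3DM instance is a
yes-instance iff the corresponding CFFA instance (with `m'` agents, uniform
utilities `s` and threshold `B`) is a yes-instance. -/
theorem n3dm_iff_cffa_cluster {α : Type*} [DecidableEq α]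
    (X Y Z : Finset α) (m' B : ℕ) (hB : 1 ≤ B)
    (hXY : Disjoint X Y) (hXZ : Disjoint X Z) (hYZ : Disjoint Y Z)
    (hX : X.card = m') (hY : Y.card = m') (hZ : Z.card = m')
    (s : α → ℕ) (hs : ∀ a ∈ X ∪ Y ∪ Z, 1 ≤ s a)
    (hsum : ∑ a ∈ X ∪ Y ∪ Z, s a = m' * B) :
    (∃ A : Fin m' → Finset α,
        (∀ i j : Fin m', i ≠ j → Disjoint (A i) (A j)) ∧
        (Finset.univ.biUnion A = X ∪ Y ∪ Z) ∧
        (∀ i : Fin m', (A i ∩ X).card = 1 ∧ (A i ∩ Y).card = 1 ∧ (A i ∩ Z).card = 1) ∧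
        (∀ i : Fin m', ∑ a ∈ A i, s a = B)) ↔
    (∃ φ : Fin m' → Finset α,
        (∀ i : Fin m', φ i ⊆ X ∪ Y ∪ Z) ∧
        (∀ i j : Fin m', i ≠ j → Disjoint (φ i) (φ j)) ∧
        (∀ i : Fin m',
          (φ i ∩ X).card ≤ 1 ∧ (φ i ∩ Y).card ≤ 1 ∧ (φ i ∩ Z).card ≤ 1) ∧
        (∀ i : Fin m', B ≤ ∑ a ∈ φ i, s a)) := by
  constructor
  · rintro ⟨A, hd, hU, hc, hB'⟩
    exact ⟨A, fun i => hU ▸ Finset.subset_biUnion_of_mem A (Finset.mem_univ i), hd,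
      fun i => ⟨(hc i).1.le, (hc i).2.1.le, (hc i).2.2.le⟩, fun i => (hB' i).ge⟩
  · rintro ⟨φ, hsub, hd, hc, hle⟩
    have hUsub : Finset.univ.biUnion φ ⊆ X ∪ Y ∪ Z :=
      Finset.biUnion_subset.mpr fun i _ => hsub i
    have hsumU : ∑ a ∈ Finset.univ.biUnion φ, s a = ∑ i, ∑ a ∈ φ i, s a :=
      Finset.sum_biUnion fun i _ j _ hij => hd i j hij
    have hconst : ∑ _i : Fin m', B = m' * B := by simp
    have hlower : ∑ _i : Fin m', B ≤ ∑ i, ∑ a ∈ φ i, s a :=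
      Finset.sum_le_sum fun i _ => hle i
    have hupper : ∑ a ∈ Finset.univ.biUnion φ, s a ≤ ∑ a ∈ X ∪ Y ∪ Z, s a :=
      Finset.sum_le_sum_of_subset hUsub
    have hU : Finset.univ.biUnion φ = X ∪ Y ∪ Z := by
      refine hUsub.antisymm fun a ha => ?_
      by_contra hna
      have := Finset.sum_lt_sum_of_subset hUsub ha hna (hs a ha) fun _ _ _ => Nat.zero_le _
      omega
    have heq : ∑ _i : Fin m', B = ∑ i, ∑ a ∈ φ i, s a := by omega
    refine ⟨φ, hd, hU, fun i => ⟨?_, ?_, ?_⟩, fun i =>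
      ((Finset.sum_eq_sum_iff_of_le fun i _ => hle i).mp heq i (Finset.mem_univ i)).symm⟩
    · exact card_inter_eq_one_of_pairwise_disjoint hd (by rw [hU]; grind) (by simpa using hX)
        (fun i => (hc i).1) i
    · exact card_inter_eq_one_of_pairwise_disjoint hd (by rw [hU]; grind) (by simpa using hY)
        (fun i => (hc i).2.1) i
    · exact card_inter_eq_one_of_pairwise_disjoint hd (by rw [hU]; grind) (by simpa using hZ)
        (fun i => (hc i).2.2) i
end

section
/- Let X, Y, Z be pairwise disjoint finite sets, each of cardinality m̃, let B be a positive integer, and let s : X ∪ Y ∪ Z → ℕ satisfy s(a) ≥ 1 for every a and ∑_{a ∈ X∪Y∪Z} s(a) = m̃·B. Then for every φ : Fin m̃ → Finset (X ∪ Y ∪ Z) with pairwise disjoint values such that for every i, |φ(i) ∩ X| ≤ 1, |φ(i) ∩ Y| ≤ 1, |φ(i) ∩ Z| ≤ 1, and ∑_{a ∈ φ(i)} s(a) ≥ B, the following hold: ∑_{a ∈ φ(i)} s(a) = B and |φ(i) ∩ X| = |φ(i) ∩ Y| = |φ(i) ∩ Z| = 1 for every i, and the bundles φ(0), …, φ(m̃−1)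 cover all of X ∪ Y ∪ Z. -/
/-- If `n` pairwise disjoint finsets cover a set with `n` elements and each meets it at most once,
then each meets it exactly once. -/
theorem card_inter_eq_one_of_subset_biUnion {α ι : Type*} [DecidableEq α] [Fintype ι]
    {W : Finset α} {φ : ι → Finset α} (hW : W.card = Fintype.card ι)
    (hdisj : ∀ i j, i ≠ j → Disjoint (φ i) (φ j)) (hcover : W ⊆ Finset.univ.biUnion φ)
    (hle : ∀ i, (φ i ∩ W).card ≤ 1) (i : ι) : (φ i ∩ W).card = 1 := by
  have hsum : ∑ i, (φ i ∩ W).card = ∑ _i : ι, 1 := by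
    rw [← Finset.card_biUnion fun i _ j _ hij =>
        (hdisj i j hij).mono Finset.inter_subset_left Finset.inter_subset_left,
      ← Finset.biUnion_inter, Finset.inter_eq_right.2 hcover, hW]
    simp
  exact (Finset.sum_eq_sum_iff_of_le fun i _ => hle i).1 hsum i (Finset.mem_univ i)

/-- A subset carrying at least the full sum of a positive function is the whole set. -/
theorem Finset.eq_of_subset_of_sum_le_of_pos {α : Type*} [DecidableEq α] {S T : Finset α}
    {s : α → ℕ} (hST : S ⊆ T) (hs : ∀ a ∈ T, 1 ≤ s a) (h : ∑ a ∈ T, s a ≤ ∑ a ∈ S, s a) :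
    S = T := by
  refine hST.antisymm fun a ha => ?_
  by_contra haS
  exact (Finset.sum_lt_sum_of_subset hST ha haS (hs a ha) fun _ _ _ => Nat.zero_le _).not_ge h

/-- Rigidity of CFFA solutions in the Numerical 3-Dimensional Matching reduction:
every CFFA solution on the cluster graph with three cliques `X`, `Y`, `Z`, uniform
utilities `s` and threshold `B` has every bundle of `s`-sum exactly `B` containing
exactly one element of each of `X`, `Y`, `Z`, and the bundles cover `X ∪ Y ∪ Z`. -/
theorem cffa_cluster_solution_rigid {α : Type*} [DecidableEq α]
    (X Y Z : Finset α) (m' B : ℕ) (hB : 1 ≤ B)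
    (hXY : Disjoint X Y) (hXZ : Disjoint X Z) (hYZ : Disjoint Y Z)
    (hX : X.card = m') (hY : Y.card = m') (hZ : Z.card = m')
    (s : α → ℕ) (hs : ∀ a ∈ X ∪ Y ∪ Z, 1 ≤ s a)
    (hsum : ∑ a ∈ X ∪ Y ∪ Z, s a = m' * B)
    (φ : Fin m' → Finset α)
    (hsub : ∀ i : Fin m', φ i ⊆ X ∪ Y ∪ Z)
    (hdisj : ∀ i j : Fin m', i ≠ j → Disjoint (φ i) (φ j))
    (hindep : ∀ i : Fin m',
      (φ i ∩ X).card ≤ 1 ∧ (φ i ∩ Y).card ≤ 1 ∧ (φ i ∩ Z).card ≤ 1)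
    (hutil : ∀ i : Fin m', B ≤ ∑ a ∈ φ i, s a) :
    (∀ i : Fin m', ∑ a ∈ φ i, s a = B) ∧
    (∀ i : Fin m',
      (φ i ∩ X).card = 1 ∧ (φ i ∩ Y).card = 1 ∧ (φ i ∩ Z).card = 1) ∧
    Finset.univ.biUnion φ = X ∪ Y ∪ Z := by
  have hU : ∑ a ∈ Finset.univ.biUnion φ, s a = ∑ i, ∑ a ∈ φ i, s a :=
    Finset.sum_biUnion fun i _ j _ hij => hdisj i j hij
  have hconst : ∑ _i : Fin m', B = m' * B := by simp
  have hlow : ∑ _i : Fin m', B ≤ ∑ i, ∑ a ∈ φ i, s a :=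
    Finset.sum_le_sum fun i _ => hutil i
  have hcover : Finset.univ.biUnion φ = X ∪ Y ∪ Z :=
    Finset.eq_of_subset_of_sum_le_of_pos (Finset.biUnion_subset.2 fun i _ => hsub i) hs
      (by rw [hsum, hU, ← hconst]; exact hlow)
  have htotal : ∑ _i : Fin m', B = ∑ i, ∑ a ∈ φ i, s a := by
    rw [← hU, hcover, hsum, hconst]
  have hone : ∀ W : Finset α, W.card = m' → W ⊆ X ∪ Y ∪ Z → (∀ i, (φ i ∩ W).card ≤ 1) →
      ∀ i, (φ i ∩ W).card = 1 := fun W hW hsubW hle =>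
    card_inter_eq_one_of_subset_biUnion (by simpa using hW) hdisj (hcover ▸ hsubW) hle
  refine ⟨fun i => ?_, fun i => ⟨?_, ?_, ?_⟩, hcover⟩
  · exact ((Finset.sum_eq_sum_iff_of_le fun i _ => hutil i).1 htotal i (Finset.mem_univ i)).symm
  · exact hone X hX (fun a ha => by simp [ha]) (fun i => (hindep i).1) i
  · exact hone Y hY (fun a ha => by simp [ha]) (fun i => (hindep i).2.1) i
  · exact hone Z hZ (fun a ha => by simp [ha]) (fun i => (hindep i).2.2) i
end

section
/- Let V be a finite set, let c : V → Fin ℓ assign each vertex to a clique, let w : V → ℕ, and let k, ρ be natural numbers. There exists S ⊆ V with |S| ≤ k such that c is injective on S and ∑_{v ∈ S} w(v) ≥ ρ, if and only if there exists T ⊆ Fin ℓ with |T| ≤ k such that ∑_{j ∈ T} max{ w(v) : v ∈ V, c(v) = j } ≥ ρ, where the maximum over an empty fiber is 0. -/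
/-- A nonempty fiber of `c` contains a vertex of maximum weight. -/
theorem exists_eq_sup_fiber {V ι : Type*} [Fintype V] [DecidableEq ι]
    (c : V → ι) (w : V → ℕ) {j : ι} (hj : ∃ u, c u = j) :
    ∃ v, c v = j ∧ (Finset.univ.filter fun v => c v = j).sup w = w v := by
  obtain ⟨u, hu⟩ := hj
  obtain ⟨v, hv, hw⟩ := Finset.exists_mem_eq_sup (Finset.univ.filter fun v => c v = j)
    ⟨u, by simpa using hu⟩ w
  exact ⟨v, by simpa using hv, hw⟩

/-- Correctness of the greedy algorithm for Sb-MWIS on cluster graphs: on the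
cluster graph whose cliques are the fibers of `c : V → Fin ℓ`, there is an
independent set (a set on which `c` is injective) of size at most `k` and weight
at least `ρ` iff some collection `T` of at most `k` cliques has total
maximum-fiber-weight at least `ρ`. -/
theorem sbmwis_cluster_greedy {V : Type*} [Fintype V] [DecidableEq V]
    (ℓ : ℕ) (c : V → Fin ℓ) (w : V → ℕ) (k ρ : ℕ) :
    (∃ S : Finset V, S.card ≤ k ∧ Set.InjOn c ↑S ∧ ρ ≤ ∑ v ∈ S, w v) ↔
    (∃ T : Finset (Fin ℓ), T.card ≤ k ∧
      ρ ≤ ∑ j ∈ T, (Finset.univ.filter fun v => c v = j).sup w) := by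
  classical
  constructor
  · rintro ⟨S, hS, hc, hρ⟩
    refine ⟨S.image c, Finset.card_image_le.trans hS, hρ.trans ?_⟩
    rw [Finset.sum_image hc]
    exact Finset.sum_le_sum fun v _ => Finset.le_sup (f := w) (by simp)
  · rintro ⟨T, hT, hρ⟩
    cases isEmpty_or_nonempty V with
    | inl _ => exact ⟨∅, by simp, by simp, by simpa using hρ⟩
    | inr _ =>
      have hmax : ∀ j, ∃ v, (∃ u, c u = j) →
          c v = j ∧ (Finset.univ.filter fun v => c v = j).sup w = w v := fun j => by
        by_cases hj : ∃ u, c u = j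
        · exact (exists_eq_sup_fiber c w hj).imp fun _ h _ => h
        · exact ⟨Classical.arbitrary V, fun h => absurd h hj⟩
      choose f hf using hmax
      set T' := T.filter fun j => ∃ u, c u = j
      have hcf : ∀ j ∈ T', c (f j) = j := fun j hj => (hf j (Finset.mem_filter.mp hj).2).1
      have hinj : Set.InjOn f T' := fun i hi j hj hij => by
        rw [← hcf i hi, ← hcf j hj, hij]
      refine ⟨T'.image f,
        Finset.card_image_le.trans ((Finset.card_filter_le _ _).trans hT), ?_, ?_⟩
      · rw [Finset.coe_image]
        rintro _ ⟨i, hi, rfl⟩ _ ⟨j, hj, rfl⟩ hij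
        rw [← hcf i hi, ← hcf j hj, hij]
      · rw [Finset.sum_image hinj]
        refine hρ.trans_eq ?_
        rw [← Finset.sum_congr rfl fun j hj => (hf j (Finset.mem_filter.mp hj).2).2]
        refine (Finset.sum_subset (Finset.filter_subset _ _) fun j hj hj' => ?_).symm
        have hempty : (Finset.univ.filter fun v => c v = j) = ∅ :=
          Finset.filter_eq_empty_iff.mpr fun v _ hv =>
            hj' (Finset.mem_filter.mpr ⟨hj, v, hv⟩)
        rw [hempty, Finset.sup_empty, bot_eq_zero]
end

section
/- Let H be a simple graph on a finite vertex set V and let t be the number of unordered pairs of distinct non-adjacent vertices of H, with t ≥ 1. Then the number of independent sets of H of cardinality at least 2 is at most 2·t · 2^(2·√t) (with √t the real square root and the inequality read in the reals). -/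
namespace SimpleGraph

variable {V : Type*} [Fintype V] (G : SimpleGraph V) [DecidableRel G.Adj]

/-- The neighbours of `u` whose degree is at least that of `u`. -/
def upperNeighborFinset (u : V) : Finset V :=
  {w ∈ G.neighborFinset u | G.degree u ≤ G.degree w}

theorem card_upperNeighborFinset_sq_le (u : V) :
    (G.upperNeighborFinset u).card ^ 2 ≤ 2 * G.edgeFinset.card := by
  have hle : (G.upperNeighborFinset u).card ≤ G.degree u :=
    Finset.card_le_card (Finset.filter_subset _ _)
  calc (G.upperNeighborFinset u).card ^ 2
      = ∑ _w ∈ G.upperNeighborFinset u, (G.upperNeighborFinset u).card := by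
        rw [Finset.sum_const, smul_eq_mul, sq]
    _ ≤ ∑ w ∈ G.upperNeighborFinset u, G.degree w :=
        Finset.sum_le_sum fun w hw => hle.trans (Finset.mem_filter.mp hw).2
    _ ≤ ∑ w, G.degree w := Finset.sum_le_sum_of_subset (Finset.subset_univ _)
    _ = 2 * G.edgeFinset.card := G.sum_degrees_eq_twice_card_edges

theorem two_pow_card_upperNeighborFinset_le (u : V) :
    (2 : ℝ) ^ (G.upperNeighborFinset u).card ≤ 2 ^ (2 * Real.sqrt G.edgeFinset.card) := by
  rw [← Real.rpow_natCast]
  refine Real.rpow_le_rpow_of_exponent_le one_le_two (abs_le_of_sq_le_sq' ?_ (by positivity)).2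
  have h : ((G.upperNeighborFinset u).card : ℝ) ^ 2 ≤ 2 * G.edgeFinset.card := by
    exact_mod_cast G.card_upperNeighborFinset_sq_le u
  rw [mul_pow, Real.sq_sqrt (Nat.cast_nonneg _)]
  linarith [(Nat.cast_nonneg G.edgeFinset.card : (0 : ℝ) ≤ _)]

variable [DecidableEq V]

/-- A clique with at least two vertices consists of a vertex `u` of minimum degree in it, which is
not isolated, together with some upper neighbours of `u`. -/
theorem mem_biUnion_of_isClique {S : Finset V} (hcard : 2 ≤ S.card) (hS : G.IsClique (S : Set V)) :
    S ∈ ({u | 0 < G.degree u} : Finset V).biUnion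
      fun u => (G.upperNeighborFinset u).powerset.image (insert u) := by
  obtain ⟨u, hu, hmin⟩ := S.exists_min_image (G.degree ·) (Finset.card_pos.mp (by omega))
  obtain ⟨w, hw, hwu⟩ := Finset.exists_mem_ne hcard u
  simp only [Finset.mem_biUnion, Finset.mem_filter, Finset.mem_univ, true_and, Finset.mem_image,
    Finset.mem_powerset]
  refine ⟨u, (G.degree_pos_iff_exists_adj u).mpr ⟨w, hS hu hw hwu.symm⟩, S.erase u, fun x hx => ?_,
    Finset.insert_erase hu⟩
  obtain ⟨hxu, hxS⟩ := Finset.mem_erase.mp hx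
  exact Finset.mem_filter.mpr
    ⟨(G.mem_neighborFinset u x).mpr (hS hu hxS hxu.symm), hmin x hxS⟩

theorem ncard_nontrivial_cliques_le :
    ({S : Finset V | 2 ≤ S.card ∧ G.IsClique (S : Set V)}.ncard : ℝ) ≤
      2 * G.edgeFinset.card * 2 ^ (2 * Real.sqrt G.edgeFinset.card) := by
  have hncard : {S : Finset V | 2 ≤ S.card ∧ G.IsClique (S : Set V)}.ncard ≤
      ∑ u with 0 < G.degree u, 2 ^ (G.upperNeighborFinset u).card := by
    refine (Set.ncard_le_ncard (fun S hS => G.mem_biUnion_of_isClique hS.1 hS.2)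
      (Finset.finite_toSet _)).trans ?_
    rw [Set.ncard_coe_finset]
    refine Finset.card_biUnion_le.trans (Finset.sum_le_sum fun u _ => ?_)
    exact Finset.card_image_le.trans (Finset.card_powerset _).le
  calc ({S : Finset V | 2 ≤ S.card ∧ G.IsClique (S : Set V)}.ncard : ℝ)
      ≤ ∑ u with 0 < G.degree u, (2 : ℝ) ^ (G.upperNeighborFinset u).card := by
        exact_mod_cast hncard
    _ ≤ ∑ u with 0 < G.degree u, (G.degree u : ℝ) * 2 ^ (2 * Real.sqrt G.edgeFinset.card) := by
        refine Finset.sum_le_sum fun u hu => (G.two_pow_card_upperNeighborFinset_le u).trans ?_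
        exact le_mul_of_one_le_left (by positivity)
          (by exact_mod_cast (Finset.mem_filter.mp hu).2)
    _ ≤ ∑ u, (G.degree u : ℝ) * 2 ^ (2 * Real.sqrt G.edgeFinset.card) :=
        Finset.sum_le_sum_of_subset_of_nonneg (Finset.subset_univ _) fun _ _ _ => by positivity
    _ = 2 * G.edgeFinset.card * 2 ^ (2 * Real.sqrt G.edgeFinset.card) := by
        rw [← Finset.sum_mul]
        congr 1
        exact_mod_cast G.sum_degrees_eq_twice_card_edges

end SimpleGraph


/-- If `t ≥ 1` is the number of unordered pairs of distinct non-adjacent vertices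
of `H` (i.e. the number of edges of the complement graph), then `H` has at most
`2·t·2^(2·√t)` independent sets of cardinality at least `2`. -/
theorem count_nontrivial_indepSets_le {V : Type*} [Fintype V] [DecidableEq V]
    (H : SimpleGraph V) [DecidableRel H.Adj] (t : ℕ) (ht : 1 ≤ t)
    (htdef : t = Hᶜ.edgeFinset.card) :
    ({S : Finset V | 2 ≤ S.card ∧
        ∀ x ∈ S, ∀ y ∈ S, x ≠ y → ¬ H.Adj x y}.ncard : ℝ) ≤
      2 * t * 2 ^ (2 * Real.sqrt t) := by
  subst htdef
  convert Hᶜ.ncard_nontrivial_cliques_le using 5 with S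
  refine and_congr_right fun _ => ⟨fun h x hx y hy hxy => ?_, fun h x hx y hy hxy => ?_⟩
  · exact (H.compl_adj x y).mpr ⟨hxy, h x hx y hy hxy⟩
  · exact ((H.compl_adj x y).mp (h hx hy hxy)).2
end

section
/- Let I be a finite set partitioned into two disjoint sets C₁ and C₂, let u : I → ℕ be a (uniform) utility function, let η ≥ 1 be a threshold, and let n be the number of agents. Let High = { x ∈ I : u(x) ≥ η }. Then the following are equivalent: (i) there exists φ : Fin n → Finset I with pairwise disjoint values such that for every i, |φ(i) ∩ C₁| ≤ 1, |φ(i) ∩ C₂| ≤ 1, and ∑_{x ∈ φ(i)} u(x) ≥ η; (ii) there exist finite sets S₁ ⊆ C₁ \ High and S₂ ⊆ C₂ \ High and a bijection g : S₁ → S₂ such that u(x) + u(g(x)) ≥ η for every x ∈ S₁ and |S₁| + |High| ≥ n. -/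
/-- A bundle meeting `C₁` and `C₂` at most once and of utility at least `η` contains an item of
utility at least `η`, or two items of smaller utility, one in each clique, that reach `η`
together. -/
lemma exists_high_or_low_pair {I : Type*} [Fintype I] [DecidableEq I]
    {C₁ C₂ : Finset I} (hdisj : Disjoint C₁ C₂) (hcover : C₁ ∪ C₂ = Finset.univ)
    {u : I → ℕ} {η : ℕ} (hη : 1 ≤ η) {s : Finset I} (h₁ : (s ∩ C₁).card ≤ 1)
    (h₂ : (s ∩ C₂).card ≤ 1) (hs : η ≤ ∑ x ∈ s, u x) :
    ∃ x ∈ s, ∃ y ∈ s, η ≤ u x ∨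
      (x ∈ C₁ ∧ y ∈ C₂ ∧ ¬ η ≤ u x ∧ ¬ η ≤ u y ∧ η ≤ u x + u y) := by
  by_cases hhigh : ∃ x ∈ s, η ≤ u x
  · obtain ⟨x, hx, hux⟩ := hhigh
    exact ⟨x, hx, x, hx, Or.inl hux⟩
  push Not at hhigh
  have hsum : ∑ x ∈ s, u x = ∑ x ∈ s ∩ C₁, u x + ∑ x ∈ s ∩ C₂, u x := by
    rw [← Finset.sum_union (hdisj.mono Finset.inter_subset_right Finset.inter_subset_right),
      ← Finset.inter_union_distrib_left, hcover, Finset.inter_univ]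
  have hcases (C : Finset I) (hC : (s ∩ C).card ≤ 1) :
      ∑ x ∈ s ∩ C, u x = 0 ∨ ∃ x ∈ s, x ∈ C ∧ ∑ x ∈ s ∩ C, u x = u x := by
    rcases (s ∩ C).eq_empty_or_nonempty with h | ⟨x, hx⟩
    · simp [h]
    · have hxC := Finset.mem_inter.1 hx
      have heq : s ∩ C = {x} :=
        Finset.eq_singleton_iff_unique_mem.2
          ⟨hx, fun y hy => Finset.card_le_one.1 hC y hy x hx⟩
      exact Or.inr ⟨x, hxC.1, hxC.2, by rw [heq, Finset.sum_singleton]⟩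
  rcases hcases C₁ h₁ with h | ⟨x, hx, hxC, hux⟩ <;>
    rcases hcases C₂ h₂ with h' | ⟨y, hy, hyC, huy⟩
  · omega
  · have := hhigh y hy
    omega
  · have := hhigh x hx
    omega
  · have := hhigh x hx
    have := hhigh y hy
    exact ⟨x, hx, y, hy, Or.inr ⟨hxC, hyC, by omega, by omega, by omega⟩⟩


/-- Correctness of the matching-based algorithm for CFFA with uniform utilities on
a cluster graph with two cliques `C₁`, `C₂`: an allocation for `n` agents with
threshold `η` exists iff there is a matching between low-utility jobs of the two
cliques, of pairwise utility sums at least `η`, whose size together with the number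
of high-utility jobs is at least `n`. -/
theorem cffa_two_cliques_uniform {I : Type*} [Fintype I] [DecidableEq I]
    (C₁ C₂ : Finset I) (hdisj : Disjoint C₁ C₂) (hcover : C₁ ∪ C₂ = Finset.univ)
    (u : I → ℕ) (η : ℕ) (hη : 1 ≤ η) (n : ℕ) :
    (∃ φ : Fin n → Finset I,
        (∀ i j : Fin n, i ≠ j → Disjoint (φ i) (φ j)) ∧
        (∀ i : Fin n, (φ i ∩ C₁).card ≤ 1 ∧ (φ i ∩ C₂).card ≤ 1) ∧
        (∀ i : Fin n, η ≤ ∑ x ∈ φ i, u x)) ↔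
    (∃ S₁ S₂ : Finset I, ∃ g : I → I,
        S₁ ⊆ C₁ \ (Finset.univ.filter fun x => η ≤ u x) ∧
        S₂ ⊆ C₂ \ (Finset.univ.filter fun x => η ≤ u x) ∧
        Set.BijOn g ↑S₁ ↑S₂ ∧
        (∀ x ∈ S₁, η ≤ u x + u (g x)) ∧
        n ≤ S₁.card + (Finset.univ.filter fun x => η ≤ u x).card) := by
  constructor
  · rintro ⟨φ, hφ, hcard, hsum⟩
    choose a ha b hb hab using fun i =>
      exists_high_or_low_pair hdisj hcover hη (hcard i).1 (hcard i).2 (hsum i)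
    have hinj {f : Fin n → I} (hf : ∀ i, f i ∈ φ i) : Function.Injective f := by
      intro i j hij
      by_contra hne
      exact Finset.disjoint_left.1 (hφ i j hne) (hf i) (hij ▸ hf j)
    have hg (i : Fin n) : Function.extend a b id (a i) = b i := (hinj ha).extend_apply _ _ _
    set High := Finset.univ.filter fun x => η ≤ u x with hHigh
    set S := Finset.univ.image a \ High with hS
    have hmem {x : I} (hx : x ∈ S) : ∃ i, a i = x ∧ a i ∈ C₁ ∧ b i ∈ C₂ ∧
        ¬ η ≤ u (a i) ∧ ¬ η ≤ u (b i) ∧ η ≤ u (a i) + u (b i) := by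
      simp only [hS, hHigh, Finset.mem_sdiff, Finset.mem_image, Finset.mem_univ, true_and,
        Finset.mem_filter] at hx
      obtain ⟨⟨i, rfl⟩, hi⟩ := hx
      exact ⟨i, rfl, (hab i).resolve_left hi⟩
    refine ⟨S, S.image (Function.extend a b id), Function.extend a b id, ?_, ?_, ?_, ?_, ?_⟩
    · intro x hx
      obtain ⟨i, rfl, h₁, -, hlow, -⟩ := hmem hx
      simp [hHigh, h₁, hlow]
    · intro y hy
      obtain ⟨x, hx, rfl⟩ := Finset.mem_image.1 hy
      obtain ⟨i, rfl, -, h₂, -, hlow, -⟩ := hmem hx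
      simp [hg, hHigh, h₂, hlow]
    · rw [Finset.coe_image]
      refine Set.InjOn.bijOn_image fun x hx y hy hxy => ?_
      obtain ⟨i, rfl, -⟩ := hmem hx
      obtain ⟨j, rfl, -⟩ := hmem hy
      rw [hg, hg] at hxy
      rw [hinj hb hxy]
    · intro x hx
      obtain ⟨i, rfl, -, -, -, -, h⟩ := hmem hx
      rwa [hg]
    · calc n = (Finset.univ.image a).card := by
            rw [Finset.card_image_of_injective _ (hinj ha), Finset.card_fin]
        _ ≤ S.card + High.card := Finset.card_le_card_sdiff_add_card
  · rintro ⟨S₁, S₂, g, hS₁, hS₂, hg, hsum, hn⟩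
    set High := Finset.univ.filter fun x => η ≤ u x with hHigh
    have hmemHigh (x : I) : x ∈ High ↔ η ≤ u x := by simp [hHigh]
    have hlow {x : I} (hx : x ∈ S₁) : x ∈ C₁ ∧ x ∉ High := Finset.mem_sdiff.1 (hS₁ hx)
    have hglow {x : I} (hx : x ∈ S₁) : g x ∈ C₂ ∧ g x ∉ High :=
      Finset.mem_sdiff.1 (hS₂ (hg.mapsTo hx))
    have hC {x : I} (h₁ : x ∈ C₁) (h₂ : x ∈ C₂) : False := Finset.disjoint_left.1 hdisj h₁ h₂
    have hdis : Disjoint S₁ High := Finset.disjoint_left.2 fun x hx => (hlow hx).2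
    obtain ⟨e⟩ : Nonempty (Fin n ↪ ↥(S₁ ∪ High)) := by
      apply Function.Embedding.nonempty_of_card_le
      rw [Fintype.card_fin, Fintype.card_coe, Finset.card_union_of_disjoint hdis]
      exact hn
    have he (i : Fin n) : (e i : I) ∈ S₁ ∨ (e i : I) ∈ High := Finset.mem_union.1 (e i).2
    have hne {i j : Fin n} (hij : i ≠ j) : (e i : I) ≠ e j := fun h =>
      hij (e.injective (Subtype.ext h))
    refine ⟨fun i => if (e i : I) ∈ High then {(e i : I)} else {(e i : I), g (e i)},
      fun i j hij => ?_, fun i => ?_, fun i => ?_⟩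
    · have hij' := hne hij
      rw [Finset.disjoint_left]
      intro x hx hx'
      have hmem {k : Fin n} (hk : x ∈ if (e k : I) ∈ High then ({(e k : I)} : Finset I)
          else {(e k : I), g (e k)}) : x = e k ∨ ((e k : I) ∈ S₁ ∧ x = g (e k)) := by
        have := he k
        split_ifs at hk <;> simp at hk <;> tauto
      rcases hmem hx with h | ⟨hi, h⟩ <;> rcases hmem hx' with h' | ⟨hj, h'⟩
      · exact hij' (h.symm.trans h')
      · have hxg := hglow hj
        rw [← h', h] at hxg
        exact hC (hlow ((he i).resolve_right hxg.2)).1 hxg.1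
      · have hxg := hglow hi
        rw [← h, h'] at hxg
        exact hC (hlow ((he j).resolve_right hxg.2)).1 hxg.1
      · exact hij' (hg.injOn hi hj (h.symm.trans h'))
    · dsimp only
      split_ifs with h
      · exact ⟨(Finset.card_le_card Finset.inter_subset_left).trans (by simp),
          (Finset.card_le_card Finset.inter_subset_left).trans (by simp)⟩
      · have hi := (he i).resolve_right h
        have h₁ := (hlow hi).1
        have h₂ := (hglow hi).1
        constructor <;> rw [Finset.card_le_one] <;> intro x hx y hy <;>
          grind
    · dsimp only
      split_ifs with h
      · simpa using (hmemHigh _).1 h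
      · have hi := (he i).resolve_right h
        have hxg : (e i : I) ≠ g (e i) := fun hxg => hC (hlow hi).1 (by
          rw [hxg]
          exact (hglow hi).1)
        rw [Finset.sum_pair hxg]
        exact hsum _ hi
end

section
/- Let H be a simple graph on a finite vertex set V with |V| = m in which every vertex has degree exactly m − 2, let u : V → ℕ be a (uniform) utility function, let η ≥ 1 be a threshold, and let n be the number of agents. Let High = { x ∈ V : u(x) ≥ η } and let P be the set of unordered pairs {x, y} of distinct non-adjacent vertices with u(x) < η, u(y) < η, and u(x) + u(y) ≥ η. Then there exists φ : Fin n → Finset V with pairwise disjoint values such that each φ(i) is an independent set of H and ∑_{x ∈ φ(i)} u(x) ≥ η for every i, if and only if |High| + |P| ≥ n. -/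
/-- In a graph on `m` vertices, a vertex of degree at least `m - 2` has at most one non-neighbor
other than itself. -/
theorem SimpleGraph.eq_of_not_adj_of_card_sub_two_le_degree {V : Type*} [Fintype V]
    [DecidableEq V] {H : SimpleGraph V} [DecidableRel H.Adj] {x y z : V}
    (hdeg : Fintype.card V - 2 ≤ H.degree x) (hxy : x ≠ y) (hxz : x ≠ z)
    (hy : ¬ H.Adj x y) (hz : ¬ H.Adj x z) : y = z := by
  by_contra hyz
  have hdisj : Disjoint (H.neighborFinset x) {x, y, z} := by
    simp [Finset.disjoint_right, hy, hz]
  have hcard : ({x, y, z} : Finset V).card = 3 := Finset.card_eq_three.2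
    ⟨x, y, z, hxy, hxz, hyz, rfl⟩
  have hle := Finset.card_le_univ (H.neighborFinset x ∪ {x, y, z})
  rw [Finset.card_union_of_disjoint hdisj, hcard, H.card_neighborFinset_eq_degree] at hle
  omega

/-- There are `n` pairwise disjoint bundles, each containing the support of some member of `T`,
iff `T` has at least `n` members, provided the supports of the members of `T` are nonempty and
pairwise disjoint and each of them is itself a bundle. -/
theorem exists_disjoint_bundles_iff_le_card {V α : Type*} (T : Finset α)
    (supp : α → Finset V) (Q : Finset V → Prop)
    (hne : ∀ t ∈ T, (supp t).Nonempty)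
    (hdisj : ∀ s ∈ T, ∀ t ∈ T, s ≠ t → Disjoint (supp s) (supp t))
    (hsupp : ∀ t ∈ T, Q (supp t)) (hQ : ∀ S, Q S → ∃ t ∈ T, supp t ⊆ S) (n : ℕ) :
    (∃ φ : Fin n → Finset V, (∀ i j, i ≠ j → Disjoint (φ i) (φ j)) ∧ ∀ i, Q (φ i)) ↔
      n ≤ T.card := by
  constructor
  · rintro ⟨φ, hφ, hφQ⟩
    choose f hfT hf using fun i => hQ (φ i) (hφQ i)
    have hinj : Function.Injective f := by
      intro i j hij
      by_contra hne'
      obtain ⟨x, hx⟩ := hne _ (hfT i)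
      exact Finset.disjoint_left.1 (hφ i j hne') (hf i hx) (hf j (hij ▸ hx))
    simpa using Finset.card_le_card_of_injOn (s := Finset.univ) f (fun i _ => hfT i) hinj.injOn
  · intro hn
    obtain ⟨f⟩ : Nonempty (Fin n ↪ T) :=
      Function.Embedding.nonempty_of_card_le (by simpa using hn)
    exact ⟨fun i => supp (f i), fun i j hij => hdisj _ (f i).2 _ (f j).2
      fun h => hij (f.injective (Subtype.ext h)), fun i => hsupp _ (f i).2⟩

/-- Correctness of the algorithm for CFFA with uniform utilities when every vertex
of the `m`-vertex conflict graph `H` has degree `m - 2`: an allocation of pairwise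
disjoint independent bundles with utility at least `η` to `n` agents exists iff
the number of high-utility jobs plus the number of unordered independent pairs of
low-utility jobs of total utility at least `η` is at least `n`. -/
theorem cffa_degree_m_sub_two_uniform {V : Type*} [Fintype V] [DecidableEq V]
    (H : SimpleGraph V) [DecidableRel H.Adj] (m : ℕ) (hm : Fintype.card V = m)
    (hdeg : ∀ v : V, H.degree v = m - 2)
    (u : V → ℕ) (η : ℕ) (hη : 1 ≤ η) (n : ℕ) :
    (∃ φ : Fin n → Finset V,
        (∀ i j : Fin n, i ≠ j → Disjoint (φ i) (φ j)) ∧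
        (∀ i : Fin n, ∀ x ∈ φ i, ∀ y ∈ φ i, x ≠ y → ¬ H.Adj x y) ∧
        (∀ i : Fin n, η ≤ ∑ x ∈ φ i, u x)) ↔
    n ≤ (Finset.univ.filter fun x => η ≤ u x).card +
        {p : Sym2 V | ∃ x y : V, p = s(x, y) ∧ x ≠ y ∧ ¬ H.Adj x y ∧
          u x < η ∧ u y < η ∧ η ≤ u x + u y}.ncard := by
  classical
  subst hm
  have key : ∀ {x y z : V}, x ≠ y → x ≠ z → ¬ H.Adj x y → ¬ H.Adj x z → y = z :=
    fun {x _ _} => H.eq_of_not_adj_of_card_sub_two_le_degree (hdeg x).ge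
  set P : Set (Sym2 V) := {p | ∃ x y : V, p = s(x, y) ∧ x ≠ y ∧ ¬ H.Adj x y ∧
    u x < η ∧ u y < η ∧ η ≤ u x + u y} with hP
  rw [Set.ncard_eq_toFinset_card' P, ← Finset.card_disjSum,
    ← exists_disjoint_bundles_iff_le_card _ (Sum.elim singleton Sym2.toFinset)
      fun S : Finset V => (∀ x ∈ S, ∀ y ∈ S, x ≠ y → ¬ H.Adj x y) ∧ η ≤ ∑ x ∈ S, u x]
  · simp only [forall_and]
  · rintro (x | p) ht
    · simp
    · induction p with | _ x y => exact ⟨x, by simp⟩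
  · rintro (x | p) hs (y | q) ht hst
    · simpa using hst
    · simp only [Finset.inr_mem_disjSum, Finset.inl_mem_disjSum, Set.mem_toFinset, hP,
        Set.mem_ofPred_eq, Finset.mem_filter_univ] at hs ht
      obtain ⟨a, b, rfl, hab, hn, ha, hb, h⟩ := ht
      simp only [Sum.elim_inl, Sum.elim_inr, Finset.disjoint_singleton_left, Sym2.mem_toFinset,
        Sym2.mem_iff]
      rintro (rfl | rfl) <;> omega
    · simp only [Finset.inr_mem_disjSum, Finset.inl_mem_disjSum, Set.mem_toFinset, hP,
        Set.mem_ofPred_eq, Finset.mem_filter_univ] at hs ht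
      obtain ⟨a, b, rfl, hab, hn, ha, hb, h⟩ := hs
      simp only [Sum.elim_inl, Sum.elim_inr, Finset.disjoint_singleton_right, Sym2.mem_toFinset,
        Sym2.mem_iff]
      rintro (rfl | rfl) <;> omega
    · simp only [Finset.inr_mem_disjSum, Set.mem_toFinset, hP, Set.mem_ofPred_eq] at hs ht
      obtain ⟨a, b, rfl, hab, hn, -⟩ := hs
      obtain ⟨c, d, rfl, hcd, hn', -⟩ := ht
      simp only [Sum.elim_inr, Finset.disjoint_left, Sym2.mem_toFinset, Sym2.mem_iff]
      rintro x (rfl | rfl) (rfl | rfl) <;> refine hst ?_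
      · rw [key hab hcd hn hn']
      · rw [key hab hcd.symm hn (fun h => hn' h.symm), Sym2.eq_swap]
      · rw [key hab.symm hcd (fun h => hn h.symm) hn', Sym2.eq_swap]
      · rw [key hab.symm hcd.symm (fun h => hn h.symm) (fun h => hn' h.symm)]
  · rintro (x | p) ht
    · simp only [Finset.inl_mem_disjSum, Finset.mem_filter_univ] at ht
      simp [ht]
    · simp only [Finset.inr_mem_disjSum, Set.mem_toFinset, hP, Set.mem_ofPred_eq] at ht
      obtain ⟨a, b, rfl, hab, hn, -, -, h⟩ := ht
      have hn' : ¬ H.Adj b a := fun h => hn h.symm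
      simp [Sym2.toFinset_mk_eq, Finset.sum_pair hab, h, hn, hn']
  · rintro S ⟨hind, hsum⟩
    by_cases hhigh : ∃ x ∈ S, η ≤ u x
    · obtain ⟨x, hx, hux⟩ := hhigh
      exact ⟨.inl x, by simpa using hux, by simpa using hx⟩
    push Not at hhigh
    obtain ⟨x, hx⟩ : S.Nonempty := by
      by_contra! h
      simp [h] at hsum
      omega
    have hux := hhigh x hx
    obtain ⟨y, hy, hyx⟩ : ∃ y ∈ S, y ≠ x := by
      by_contra! h
      rw [Finset.sum_eq_single_of_mem x hx fun y hy hyx => absurd (h y hy) hyx] at hsum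
      omega
    have hS : S = {x, y} := by
      ext z
      simp only [Finset.mem_insert, Finset.mem_singleton]
      refine ⟨fun hz => or_iff_not_imp_left.2 fun hzx => ?_, ?_⟩
      · exact key (Ne.symm hzx) hyx.symm (hind x hx z hz (Ne.symm hzx))
          (hind x hx y hy hyx.symm)
      · rintro (rfl | rfl) <;> assumption
    refine ⟨.inr s(x, y), ?_, ?_⟩
    · simp only [Finset.inr_mem_disjSum, Set.mem_toFinset, hP, Set.mem_ofPred_eq]
      rw [hS, Finset.sum_pair hyx.symm] at hsum
      exact ⟨x, y, rfl, hyx.symm, hind x hx y hy hyx.symm, hux, hhigh y hy, hsum⟩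
    · simp [Sym2.toFinset_mk_eq, hS]
end
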